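/- For each fixed γ ∈ ℝ, μ⁽¹⁾(γ,ξ) tends to +∞ as ξ tends to −∞. -/

import Mathlib

open MeasureTheory Set Filter

/-- An admissible function on the half-line `[0,∞)`: `u` is continuous on `[0,∞)`,
locally absolutely continuous with derivative `u'` (expressed by the integral
representation), and `u`, `u'`, `t·u(t)` all belong to `L²((0,∞))`. -/
structure AdmissibleHL (u u' : ℝ → ℂ) : Prop where
  cont : ContinuousOn u (Ici 0)
  locInt : ∀ t ∈ Ici (0:ℝ), IntervalIntegrable u' volume 0 t
  ac : ∀ t ∈ Ici (0:ℝ), u t = u 0 + ∫ s in (0:ℝ)..t, u' s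
  memL2 : IntegrableOn (fun t => ‖u t‖ ^ 2) (Ioi 0)
  memL2' : IntegrableOn (fun t => ‖u' t‖ ^ 2) (Ioi 0)
  memL2t : IntegrableOn (fun t => t ^ 2 * ‖u t‖ ^ 2) (Ioi 0)

/-- The quadratic form `q[γ,ξ](u) = ∫₀^∞ (|u'|² + (t-ξ)²|u|²) dt + γ|u(0)|²`. -/
noncomputable def qform (γ ξ : ℝ) (u u' : ℝ → ℂ) : ℝ :=
  (∫ t in Ioi (0:ℝ), (‖u' t‖ ^ 2 + (t - ξ) ^ 2 * ‖u t‖ ^ 2)) + γ * ‖u 0‖ ^ 2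

/-- The ground state energy `μ⁽¹⁾(γ,ξ)`: the infimum of the Rayleigh quotients of
the quadratic form `q[γ,ξ]` over admissible functions not identically zero. -/
noncomputable def mu1 (γ ξ : ℝ) : ℝ :=
  sInf { r : ℝ | ∃ u u' : ℝ → ℂ, AdmissibleHL u u' ∧ (∃ t ∈ Ici (0:ℝ), u t ≠ 0) ∧
    r = qform γ ξ u u' / ∫ t in Ioi (0:ℝ), ‖u t‖ ^ 2 }

/-- `Θ(γ) = inf_{ξ ∈ ℝ} μ⁽¹⁾(γ,ξ)`. -/
noncomputable def Theta (γ : ℝ) : ℝ := ⨅ ξ : ℝ, mu1 γ ξ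

/-- A ground state of `H[γ,ξ]` with eigenvalue `μ`: a twice continuously differentiable
positive function on `[0,∞)`, `L²`-normalized, with `φ, φ', t²·φ(t) ∈ L²((0,∞))`,
satisfying `-φ'' + (t-ξ)²φ = μ·φ` on `[0,∞)` and the boundary condition `φ'(0) = γ·φ(0)`. -/
structure IsGroundState (γ ξ μ : ℝ) (φ φ' φ'' : ℝ → ℝ) : Prop where
  deriv1 : ∀ t ∈ Ici (0:ℝ), HasDerivWithinAt φ (φ' t) (Ici 0) t
  deriv2 : ∀ t ∈ Ici (0:ℝ), HasDerivWithinAt φ' (φ'' t) (Ici 0) t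
  cont2 : ContinuousOn φ'' (Ici 0)
  pos : ∀ t ∈ Ici (0:ℝ), 0 < φ t
  normalized : (∫ t in Ioi (0:ℝ), (φ t) ^ 2) = 1
  memL2 : IntegrableOn (fun t => (φ t) ^ 2) (Ioi 0)
  memL2' : IntegrableOn (fun t => (φ' t) ^ 2) (Ioi 0)
  memL2t : IntegrableOn (fun t => (t ^ 2 * φ t) ^ 2) (Ioi 0)
  eqn : ∀ t ∈ Ici (0:ℝ), -φ'' t + (t - ξ) ^ 2 * φ t = μ * φ t
  bc : φ' 0 = γ * φ 0

/-- Cauchy-Schwarz on an interval, against the constant function `1`. -/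
lemma sq_intervalIntegral_le {f : ℝ → ℝ} {t : ℝ} (ht : 0 ≤ t)
    (hf : IntervalIntegrable f volume 0 t)
    (hf2 : IntervalIntegrable (fun s => f s ^ 2) volume 0 t) :
    (∫ s in (0:ℝ)..t, f s) ^ 2 ≤ t * ∫ s in (0:ℝ)..t, f s ^ 2 := by
  rcases ht.eq_or_lt with rfl | hpos
  · simp
  set I := ∫ s in (0:ℝ)..t, f s
  set J := ∫ s in (0:ℝ)..t, f s ^ 2
  have hnonneg : 0 ≤ ∫ s in (0:ℝ)..t, (t * f s - I) ^ 2 :=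
    intervalIntegral.integral_nonneg ht fun s _ => sq_nonneg _
  have hexpand : ∫ s in (0:ℝ)..t, (t * f s - I) ^ 2 = t ^ 2 * J - 2 * t * I * I + t * I ^ 2 := by
    have : (fun s => (t * f s - I) ^ 2) =
        fun s => t ^ 2 * f s ^ 2 - 2 * t * I * f s + I ^ 2 := by
      funext s; ring
    rw [this, intervalIntegral.integral_add
      ((hf2.const_mul _).sub (hf.const_mul _)) intervalIntegrable_const,
      intervalIntegral.integral_sub (hf2.const_mul _) (hf.const_mul _),
      intervalIntegral.integral_const_mul, intervalIntegral.integral_const_mul,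
      intervalIntegral.integral_const, smul_eq_mul, sub_zero]
  have : 0 ≤ t * (t * J - I ^ 2) := by rw [hexpand] at hnonneg; linarith
  linarith [nonneg_of_mul_nonneg_right this hpos]

namespace AdmissibleHL

variable {u u' : ℝ → ℂ}

lemma sq_norm_zero_le (h : AdmissibleHL u u') {t : ℝ} (ht : 0 ≤ t) :
    ‖u 0‖ ^ 2 ≤ 2 * ‖u t‖ ^ 2 + 2 * t * ∫ s in Ioi (0:ℝ), ‖u' s‖ ^ 2 := by
  have hsub : IntervalIntegrable (fun s => ‖u' s‖ ^ 2) volume 0 t :=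
    (intervalIntegrable_iff_integrableOn_Ioc_of_le ht).2
      (h.memL2'.mono_set Ioc_subset_Ioi_self)
  have hcs := sq_intervalIntegral_le ht (h.locInt t ht).norm hsub
  have hmono : ∫ s in (0:ℝ)..t, ‖u' s‖ ^ 2 ≤ ∫ s in Ioi (0:ℝ), ‖u' s‖ ^ 2 := by
    rw [intervalIntegral.integral_of_le ht]
    exact setIntegral_mono_set h.memL2' (ae_of_all _ fun s => sq_nonneg _)
      Ioc_subset_Ioi_self.eventuallyLE
  have hnorm : ‖u 0‖ ≤ ‖u t‖ + ∫ s in (0:ℝ)..t, ‖u' s‖ := by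
    have h0 : u 0 = u t - ∫ s in (0:ℝ)..t, u' s := by rw [h.ac t ht]; ring
    calc ‖u 0‖ ≤ ‖u t‖ + ‖∫ s in (0:ℝ)..t, u' s‖ := by
          conv_lhs => rw [h0]
          exact norm_sub_le _ _
      _ ≤ _ := by gcongr; exact intervalIntegral.norm_integral_le_integral_norm ht
  have hsq := pow_le_pow_left₀ (norm_nonneg _) hnorm 2
  have := mul_le_mul_of_nonneg_left hmono ht
  nlinarith [sq_nonneg (‖u t‖ - ∫ s in (0:ℝ)..t, ‖u' s‖)]

/-- Trace inequality: the boundary value is controlled by the `H¹` norm, with an arbitrarily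
small weight on the derivative. -/
lemma trace_le (h : AdmissibleHL u u') {δ : ℝ} (hδ : 0 < δ) :
    ‖u 0‖ ^ 2 ≤ 2 / δ * (∫ s in Ioi (0:ℝ), ‖u s‖ ^ 2)
      + 2 * δ * ∫ s in Ioi (0:ℝ), ‖u' s‖ ^ 2 := by
  set D := ∫ s in Ioi (0:ℝ), ‖u' s‖ ^ 2
  have hD0 : 0 ≤ D := integral_nonneg fun s => sq_nonneg _
  have hu : IntervalIntegrable (fun s => ‖u s‖ ^ 2) volume 0 δ :=
    (intervalIntegrable_iff_integrableOn_Ioc_of_le hδ.le).2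
      (h.memL2.mono_set Ioc_subset_Ioi_self)
  have hmono : ∫ s in (0:ℝ)..δ, ‖u s‖ ^ 2 ≤ ∫ s in Ioi (0:ℝ), ‖u s‖ ^ 2 := by
    rw [intervalIntegral.integral_of_le hδ.le]
    exact setIntegral_mono_set h.memL2 (ae_of_all _ fun s => sq_nonneg _)
      Ioc_subset_Ioi_self.eventuallyLE
  have hint : ∫ _ in (0:ℝ)..δ, ‖u 0‖ ^ 2 ≤ ∫ t in (0:ℝ)..δ, (2 * ‖u t‖ ^ 2 + 2 * δ * D) := by
    refine intervalIntegral.integral_mono_on hδ.le intervalIntegrable_const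
      ((hu.const_mul 2).add intervalIntegrable_const) fun t ht => ?_
    refine (h.sq_norm_zero_le ht.1).trans ?_
    gcongr
    exact ht.2
  rw [intervalIntegral.integral_add (hu.const_mul 2) intervalIntegrable_const,
    intervalIntegral.integral_const_mul, intervalIntegral.integral_const,
    intervalIntegral.integral_const, smul_eq_mul, smul_eq_mul, sub_zero] at hint
  refine le_of_mul_le_mul_left ?_ hδ
  have : δ * (2 / δ * (∫ s in Ioi (0:ℝ), ‖u s‖ ^ 2) + 2 * δ * D)
      = 2 * (∫ s in Ioi (0:ℝ), ‖u s‖ ^ 2) + δ * (2 * δ * D) := by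
    field_simp
  linarith

lemma integrableOn_potential (h : AdmissibleHL u u') (ξ : ℝ) :
    IntegrableOn (fun t => (t - ξ) ^ 2 * ‖u t‖ ^ 2) (Ioi 0) := by
  refine Integrable.mono' ((h.memL2t.const_mul 2).add (h.memL2.const_mul (2 * ξ ^ 2))) ?_
    (ae_of_all _ fun t => ?_)
  · exact (by fun_prop : Continuous fun t : ℝ => (t - ξ) ^ 2).aestronglyMeasurable.mul
      h.memL2.aestronglyMeasurable
  · rw [Real.norm_of_nonneg (by positivity)]
    simp only [Pi.add_apply]
    nlinarith [mul_nonneg (sq_nonneg (t + ξ)) (sq_nonneg ‖u t‖)]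

lemma integral_sq_norm_pos (h : AdmissibleHL u u') (hne : ∃ t ∈ Ici (0:ℝ), u t ≠ 0) :
    0 < ∫ t in Ioi (0:ℝ), ‖u t‖ ^ 2 := by
  refine (integral_nonneg fun t => sq_nonneg _).lt_of_ne' fun h0 => ?_
  obtain ⟨t, ht, hut⟩ := hne
  rw [setIntegral_eq_zero_iff_of_nonneg_ae (ae_of_all _ fun t => sq_nonneg _) h.memL2,
    restrict_Ioi_eq_restrict_Ici] at h0
  have hae : u =ᵐ[volume.restrict (Ici 0)] fun _ => 0 := by
    filter_upwards [h0] with s hs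
    simpa using hs
  exact hut (Measure.eqOn_of_ae_eq hae h.cont continuousOn_const (by simp) ht)

lemma le_rayleigh (h : AdmissibleHL u u') (hne : ∃ t ∈ Ici (0:ℝ), u t ≠ 0) (γ : ℝ) {ξ : ℝ}
    (hξ : ξ ≤ 0) :
    ξ ^ 2 - 4 * (|γ| + 1) ^ 2 ≤ qform γ ξ u u' / ∫ t in Ioi (0:ℝ), ‖u t‖ ^ 2 := by
  rw [le_div_iff₀ (h.integral_sq_norm_pos hne), qform,
    integral_add h.memL2' (h.integrableOn_potential ξ)]
  set a := |γ| + 1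
  have ha0 : 0 < a := by positivity
  have htr := h.trace_le (δ := 1 / (2 * a)) (by positivity)
  set N := ∫ t in Ioi (0:ℝ), ‖u t‖ ^ 2 with hN
  set D := ∫ t in Ioi (0:ℝ), ‖u' t‖ ^ 2
  have hpot : ξ ^ 2 * N ≤ ∫ t in Ioi (0:ℝ), (t - ξ) ^ 2 * ‖u t‖ ^ 2 := by
    rw [hN, ← integral_const_mul]
    refine setIntegral_mono_on (h.memL2.const_mul _) (h.integrableOn_potential ξ)
      measurableSet_Ioi fun t ht => ?_
    have ht : 0 < t := ht
    gcongr ?_ * _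
    nlinarith
  have htr' : a * ‖u 0‖ ^ 2 ≤ 4 * a ^ 2 * N + D := by
    calc a * ‖u 0‖ ^ 2 ≤ a * (2 / (1 / (2 * a)) * N + 2 * (1 / (2 * a)) * D) := by gcongr
      _ = _ := by field_simp; ring
  have hγ : -(a * ‖u 0‖ ^ 2) ≤ γ * ‖u 0‖ ^ 2 := by
    nlinarith [neg_abs_le γ, sq_nonneg ‖u 0‖]
  linarith

end AdmissibleHL

lemma admissibleHL_exp_neg :
    AdmissibleHL (fun t => (Real.exp (-t) : ℂ)) (fun t => (-Real.exp (-t) : ℂ)) := by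
  have hderiv (t : ℝ) : HasDerivAt (fun t : ℝ => (Real.exp (-t) : ℂ)) (-Real.exp (-t) : ℂ) t := by
    have : HasDerivAt (fun t : ℝ => Real.exp (-t)) (-Real.exp (-t)) t := by
      simpa using (hasDerivAt_neg t).exp
    simpa using this.ofReal_comp
  have hcont : Continuous fun t : ℝ => (-Real.exp (-t) : ℂ) := by fun_prop
  have hsq : IntegrableOn (fun t : ℝ => Real.exp (-t) ^ 2) (Ioi 0) := by
    refine (integrableOn_exp_mul_Ioi (a := -2) (by norm_num) 0).congr_fun (fun t _ => ?_)
      measurableSet_Ioi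
    simp only [← Real.exp_nat_mul]
    congr 1
    push_cast
    ring
  refine ⟨by fun_prop, fun t _ => hcont.intervalIntegrable _ _, fun t _ => ?_, ?_, ?_, ?_⟩
  · rw [intervalIntegral.integral_eq_sub_of_hasDerivAt (fun s _ => hderiv s)
      (hcont.intervalIntegrable _ _)]
    ring
  · simpa [Complex.norm_real, abs_of_pos, Real.exp_pos, -Complex.ofReal_exp] using hsq
  · simpa [Complex.norm_real, abs_of_pos, Real.exp_pos, -Complex.ofReal_exp] using hsq
  · refine (integrableOn_rpow_mul_exp_neg_mul_rpow (p := 1) (s := 2) (b := 2) (by norm_num)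
      (by norm_num) (by norm_num)).congr_fun (fun t _ => ?_) measurableSet_Ioi
    simp only [Complex.norm_real, Real.norm_eq_abs, Real.abs_exp, ← Real.exp_nat_mul,
      Real.rpow_one, Real.rpow_two]
    congr 2
    push_cast
    ring

lemma le_mu1 (γ : ℝ) {ξ : ℝ} (hξ : ξ ≤ 0) : ξ ^ 2 - 4 * (|γ| + 1) ^ 2 ≤ mu1 γ ξ := by
  refine le_csInf ⟨_, _, _, admissibleHL_exp_neg, ⟨0, self_mem_Ici, by simp⟩, rfl⟩ ?_
  rintro r ⟨u, u', h, hne, rfl⟩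
  exact h.le_rayleigh hne γ hξ

/-- For each fixed `γ`, `μ⁽¹⁾(γ,ξ) → +∞` as `ξ → −∞`. -/
theorem mu1_tendsto_atTop (γ : ℝ) :
    Tendsto (fun ξ : ℝ => mu1 γ ξ) atBot atTop := by
  refine tendsto_atTop_mono' (f₁ := fun ξ : ℝ => ξ ^ 2 - 4 * (|γ| + 1) ^ 2) _ ?_ ?_
  · filter_upwards [eventually_le_atBot 0] with ξ hξ using le_mu1 γ hξ
  · have hsq : Tendsto (fun ξ : ℝ => ξ ^ 2) atBot atTop := by
      simpa [pow_two] using tendsto_id.atBot_mul_atBot₀ (tendsto_id (α := ℝ))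
    simpa [sub_eq_add_neg] using tendsto_atTop_add_const_right _ (-(4 * (|γ| + 1) ^ 2)) hsq
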